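/- arXiv:1302.4063 — 3 statements merged into one kernel-verified Lean document; each statement's English description precedes it below -/
import Mathlib

section
/- For every integer n ≥ 1, the sum of the last part c_k over all compositions (c₁,…,c_k) of n equals 2^n − 1, and the sum of c_k(c_k − 1) over all compositions (c₁,…,c_k) of n equals 2^{n+1} − 2n − 2. -/
namespace Composition

/-- Prepend a part equal to `1`. -/
def consOne {n : ℕ} (c : Composition n) : Composition (n + 1) where
  blocks := 1 :: c.blocks
  blocks_pos := by
    intro i hi
    rcases List.mem_cons.1 hi with rfl | hi
    · exact one_pos
    · exact c.blocks_pos hi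
  blocks_sum := by simp [c.blocks_sum, add_comm]

theorem exists_blocks_eq_cons {n : ℕ} (c : Composition (n + 1)) :
    ∃ a l, c.blocks = (a + 1) :: l := by
  have hne : c.blocks ≠ [] := by simp [c.blocks_eq_nil]
  obtain ⟨b, l, h⟩ := List.exists_cons_of_ne_nil hne
  have hb : 0 < b := c.blocks_pos (by simp [h])
  exact ⟨b - 1, l, by rw [h, Nat.sub_add_cancel hb]⟩

/-- Increase the first part by `1`. -/
def succHead {n : ℕ} (c : Composition (n + 1)) : Composition (n + 2) where
  blocks := c.blocks.modifyHead (· + 1)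
  blocks_pos := by
    intro i hi
    obtain ⟨a, l, h⟩ := c.exists_blocks_eq_cons
    rw [h, List.modifyHead_cons, List.mem_cons] at hi
    rcases hi with rfl | hi
    · exact Nat.succ_pos _
    · exact c.blocks_pos (by simp [h, hi])
  blocks_sum := by
    obtain ⟨a, l, h⟩ := c.exists_blocks_eq_cons
    have hs := c.blocks_sum
    simp only [h, List.modifyHead_cons, List.sum_cons] at hs ⊢
    omega

theorem bijective_consOne_succHead (n : ℕ) :
    Function.Bijective
      (Sum.elim consOne succHead : Composition (n + 1) ⊕ Composition (n + 1) → _) := by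
  rw [Fintype.bijective_iff_injective_and_card]
  refine ⟨?_, by simp [composition_card, pow_succ, mul_two]⟩
  rintro (c | c) (d | d) h <;>
    obtain ⟨a, l, hc⟩ := c.exists_blocks_eq_cons <;>
    obtain ⟨b, m, hd⟩ := d.exists_blocks_eq_cons <;>
    have h' := congrArg Composition.blocks h <;>
    simp [consOne, succHead, hc, hd] at h'
  all_goals
    congr 1
    apply Composition.ext
    simp [hc, hd, h']

theorem sum_headD_add_two {M : Type*} [AddCommMonoid M] (n : ℕ) (f : ℕ → M) :
    ∑ c : Composition (n + 2), f (c.blocks.headD 0) =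
      2 ^ n • f 1 + ∑ c : Composition (n + 1), f (c.blocks.headD 0 + 1) := by
  rw [← (bijective_consOne_succHead n).sum_comp fun c => f (c.blocks.headD 0),
    Fintype.sum_sum_type]
  congr 1
  · simp [consOne, composition_card]
  · refine Finset.sum_congr rfl fun c _ => ?_
    obtain ⟨a, l, h⟩ := c.exists_blocks_eq_cons
    simp [succHead, h]

theorem sum_getLastD_eq_sum_headD {M : Type*} [AddCommMonoid M] (n : ℕ) (f : ℕ → M) :
    ∑ c : Composition n, f (c.blocks.getLastD 0) =
      ∑ c : Composition n, f (c.blocks.headD 0) := by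
  rw [← (reverse_involutive (n := n)).bijective.sum_comp fun c => f (c.blocks.headD 0)]
  refine Finset.sum_congr rfl fun c _ => ?_
  simp [reverse, List.getLastD_eq_getLast?, List.headD_eq_head?_getD]

theorem sum_headD_one {M : Type*} [AddCommMonoid M] (f : ℕ → M) :
    ∑ c : Composition (0 + 1), f (c.blocks.headD 0) = f 1 := by
  have : Subsingleton (Composition (0 + 1)) :=
    Fintype.card_le_one_iff_subsingleton.1 (by simp [composition_card])
  rw [Fintype.sum_subsingleton _ (single 1 one_pos)]
  simp

theorem sum_headD_add_one (n : ℕ) :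
    ∑ c : Composition (n + 1), (c.blocks.headD 0 : ℤ) = 2 ^ (n + 1) - 1 := by
  induction n with
  | zero => exact (sum_headD_one (fun k => (k : ℤ))).trans (by norm_num)
  | succ n ih =>
    rw [sum_headD_add_two n (fun k => (k : ℤ))]
    simp only [Nat.cast_add, Nat.cast_one, Finset.sum_add_distrib, ih]
    simp [composition_card]
    ring

theorem sum_headD_mul_pred_add_one (n : ℕ) :
    ∑ c : Composition (n + 1), (c.blocks.headD 0 : ℤ) * ((c.blocks.headD 0 : ℤ) - 1) =
      2 ^ (n + 2) - 2 * (n + 1) - 2 := by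
  induction n with
  | zero => exact (sum_headD_one (fun k => (k : ℤ) * ((k : ℤ) - 1))).trans (by norm_num)
  | succ n ih =>
    rw [sum_headD_add_two n (fun k => (k : ℤ) * ((k : ℤ) - 1))]
    have h (x : ℤ) : (x + 1) * (x + 1 - 1) = x * (x - 1) + 2 * x := by ring
    simp only [Nat.cast_add, Nat.cast_one, h, Finset.sum_add_distrib, ih, ← Finset.mul_sum,
      sum_headD_add_one]
    simp
    ring

end Composition

/-- Lemma 2 (Lemma `com1`): for `n ≥ 1`, the sum of the last part `c_k` over all
compositions of `n` is `2^n − 1`, and the sum of `c_k(c_k − 1)` over all compositions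
of `n` is `2^{n+1} − 2n − 2`. -/
theorem stmt_0 (n : ℕ) (hn : 1 ≤ n) :
    (∑ c : Composition n, (c.blocks.getLastD 0 : ℤ)) = 2 ^ n - 1 ∧
    (∑ c : Composition n, (c.blocks.getLastD 0 : ℤ) * ((c.blocks.getLastD 0 : ℤ) - 1)) =
      2 ^ (n + 1) - 2 * n - 2 := by
  obtain ⟨n, rfl⟩ := Nat.exists_eq_add_of_le' hn
  rw [Composition.sum_getLastD_eq_sum_headD (n + 1) (fun k => (k : ℤ)),
    Composition.sum_getLastD_eq_sum_headD (n + 1) (fun k => (k : ℤ) * ((k : ℤ) - 1))]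
  refine ⟨Composition.sum_headD_add_one n, ?_⟩
  simpa using Composition.sum_headD_mul_pred_add_one n
end

section
/- For every integer n ≥ 3, the total number of occurrences of the pattern 213 in the set S_n(123,132) equals the sum over all compositions (c₁,…,c_k) of n of ∑_{i=1}^{k} binom(c_i−1, 2), and the total number of occurrences of the pattern 231 in S_n(123,132) equals the sum over all compositions (c₁,…,c_k) of n of ∑_{i=1}^{k−1} ∑_{j=i+1}^{k} c_j(c_i−1). -/
open Finset

/-- Number of occurrences of the length-3 pattern `q` (given by its sequence of values)
in the permutation `σ` of `Fin n`: triples of indices `ι 0 < ι 1 < ι 2` whose values under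
`σ` are in the same relative order as the values of `q`. -/
def occ (n : ℕ) (q : Fin 3 → ℕ) (σ : Equiv.Perm (Fin n)) : ℕ :=
  (Finset.univ.filter fun ι : Fin 3 → Fin n =>
    (∀ j l : Fin 3, j < l → ι j < ι l) ∧
    (∀ j l : Fin 3, q j < q l ↔ σ (ι j) < σ (ι l))).card

/-- The set `S_n(R)` of permutations of `{1,…,n}` avoiding every pattern in `R`. -/
def avoiders (n : ℕ) (R : List (Fin 3 → ℕ)) : Finset (Equiv.Perm (Fin n)) :=
  Finset.univ.filter fun σ => ∀ q ∈ R, occ n q σ = 0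

/-- `f_q(S_n(R))`: the total number of occurrences of the pattern `q` among
all permutations in `S_n(R)`. -/
def fCnt (n : ℕ) (q : Fin 3 → ℕ) (R : List (Fin 3 → ℕ)) : ℕ :=
  ∑ σ ∈ avoiders n R, occ n q σ

def p123 : Fin 3 → ℕ := ![1, 2, 3]
def p132 : Fin 3 → ℕ := ![1, 3, 2]
def p213 : Fin 3 → ℕ := ![2, 1, 3]
def p231 : Fin 3 → ℕ := ![2, 3, 1]
def p312 : Fin 3 → ℕ := ![3, 1, 2]
def p321 : Fin 3 → ℕ := ![3, 2, 1]

/-- Occurrences of a pattern of length `3`, counted as a sum over triples of positions. -/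
theorem occ_eq_sum (n : ℕ) (q : Fin 3 → ℕ) (σ : Equiv.Perm (Fin n)) :
    occ n q σ = ∑ a, ∑ b, ∑ c, if (∀ j l : Fin 3, j < l → ![a, b, c] j < ![a, b, c] l) ∧
      (∀ j l : Fin 3, q j < q l ↔ σ (![a, b, c] j) < σ (![a, b, c] l)) then 1 else 0 := by
  let e : (Fin n × Fin n × Fin n) ≃ (Fin 3 → Fin n) :=
    { toFun := fun x => ![x.1, x.2.1, x.2.2]
      invFun := fun f => (f 0, f 1, f 2)
      left_inv := fun x => rfl
      right_inv := fun f => by ext i; fin_cases i <;> rfl }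
  rw [occ, Finset.card_filter, ← e.sum_comp, Fintype.sum_prod_type]
  refine Finset.sum_congr rfl fun a _ => ?_
  rw [Fintype.sum_prod_type]
  rfl

theorem occ_p123 (n : ℕ) (σ : Equiv.Perm (Fin n)) :
    occ n p123 σ = ∑ a, ∑ b, ∑ c, if a < b ∧ b < c ∧ σ a < σ b ∧ σ b < σ c then 1 else 0 := by
  rw [occ_eq_sum]
  refine sum_congr rfl fun a _ => sum_congr rfl fun b _ => sum_congr rfl fun c _ => ?_
  congr 1
  simp only [Fin.forall_fin_succ, p123]
  simp
  grind

theorem occ_p132 (n : ℕ) (σ : Equiv.Perm (Fin n)) :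
    occ n p132 σ = ∑ a, ∑ b, ∑ c, if a < b ∧ b < c ∧ σ a < σ c ∧ σ c < σ b then 1 else 0 := by
  rw [occ_eq_sum]
  refine sum_congr rfl fun a _ => sum_congr rfl fun b _ => sum_congr rfl fun c _ => ?_
  congr 1
  simp only [Fin.forall_fin_succ, p132]
  simp
  grind

theorem occ_p213 (n : ℕ) (σ : Equiv.Perm (Fin n)) :
    occ n p213 σ = ∑ a, ∑ b, ∑ c, if a < b ∧ b < c ∧ σ b < σ a ∧ σ a < σ c then 1 else 0 := by
  rw [occ_eq_sum]
  refine sum_congr rfl fun a _ => sum_congr rfl fun b _ => sum_congr rfl fun c _ => ?_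
  congr 1
  simp only [Fin.forall_fin_succ, p213]
  simp
  grind

theorem occ_p231 (n : ℕ) (σ : Equiv.Perm (Fin n)) :
    occ n p231 σ = ∑ a, ∑ b, ∑ c, if a < b ∧ b < c ∧ σ c < σ a ∧ σ a < σ b then 1 else 0 := by
  rw [occ_eq_sum]
  refine sum_congr rfl fun a _ => sum_congr rfl fun b _ => sum_congr rfl fun c _ => ?_
  congr 1
  simp only [Fin.forall_fin_succ, p231]
  simp
  grind

/-- Every entry of `σ` is followed by at most one larger entry. -/
def AtMostOneLarger {n : ℕ} (σ : Equiv.Perm (Fin n)) : Prop :=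
  ∀ a b c, a < b → b < c → ¬ (σ a < σ b ∧ σ a < σ c)

theorem mem_avoiders_iff (n : ℕ) (σ : Equiv.Perm (Fin n)) :
    σ ∈ avoiders n [p123, p132] ↔ AtMostOneLarger σ := by
  simp only [avoiders, mem_filter_univ, List.forall_mem_cons, List.not_mem_nil,
    IsEmpty.forall_iff, implies_true, and_true, occ_p123, occ_p132, sum_eq_zero_iff, mem_univ,
    forall_true_left, ite_eq_right_iff, one_ne_zero, imp_false, AtMostOneLarger]
  constructor
  · rintro ⟨h1, h2⟩ a b c hab hbc ⟨hb, hc⟩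
    rcases lt_or_gt_of_ne (σ.injective.ne hbc.ne) with h | h
    · exact h1 a b c ⟨hab, hbc, hb, h⟩
    · exact h2 a b c ⟨hab, hbc, hc, h⟩
  · intro h
    exact ⟨fun a b c ⟨hab, hbc, h1, h2⟩ => h a b c hab hbc ⟨h1, h1.trans h2⟩,
      fun a b c ⟨hab, hbc, h1, h2⟩ => h a b c hab hbc ⟨h1.trans h2, h1⟩⟩

/-- The permutation of `Fin (n + 1)` whose first value is `v` and whose remaining values are in
the same relative order as those of `σ`. -/
def prependValue {n : ℕ} (v : Fin (n + 1)) (σ : Equiv.Perm (Fin n)) : Equiv.Perm (Fin (n + 1)) :=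
  ((finSuccEquiv' 0).trans (Equiv.optionCongr σ)).trans (finSuccEquiv' v).symm

@[simp] theorem prependValue_zero {n : ℕ} (v : Fin (n + 1)) (σ : Equiv.Perm (Fin n)) :
    prependValue v σ 0 = v := by
  simp [prependValue]

@[simp] theorem prependValue_succ {n : ℕ} (v : Fin (n + 1)) (σ : Equiv.Perm (Fin n)) (i : Fin n) :
    prependValue v σ i.succ = v.succAbove (σ i) := by
  have : finSuccEquiv' (0 : Fin (n + 1)) i.succ = some i := by
    rw [← Fin.succAbove_zero, finSuccEquiv'_succAbove]
  simp [prependValue, this]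

theorem prependValue_bijective (n : ℕ) : Function.Bijective
    (fun x : Fin (n + 1) × Equiv.Perm (Fin n) => prependValue x.1 x.2) := by
  rw [Fintype.bijective_iff_injective_and_card]
  constructor
  · rintro ⟨v, σ⟩ ⟨w, τ⟩ h
    have h0 := DFunLike.congr_fun h 0
    simp only [prependValue_zero] at h0
    subst h0
    congr 1
    ext i
    have hi := DFunLike.congr_fun h i.succ
    simp only [prependValue_succ] at hi
    rw [Fin.succAbove_right_injective hi]
  · simp [Fintype.card_perm, Nat.factorial_succ]

theorem castSucc_last_succAbove_lt {n : ℕ} (x : Fin (n + 1)) :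
    (Fin.last n).castSucc.succAbove x < (Fin.last n).castSucc ↔ x < Fin.last n := by
  simp [Fin.succAbove_lt_iff_castSucc_lt]

theorem castSucc_last_lt_succAbove {n : ℕ} (x : Fin (n + 1)) :
    (Fin.last n).castSucc < (Fin.last n).castSucc.succAbove x ↔ x = Fin.last n := by
  rw [Fin.lt_succAbove_iff_le_castSucc, Fin.castSucc_le_castSucc_iff, Fin.last_le_iff]

theorem atMostOneLarger_prependValue_iff {n : ℕ} (v : Fin (n + 1)) (σ : Equiv.Perm (Fin n)) :
    AtMostOneLarger (prependValue v σ) ↔ AtMostOneLarger σ ∧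
      ∀ b c, b < c → ¬ (v < v.succAbove (σ b) ∧ v < v.succAbove (σ c)) := by
  simp only [AtMostOneLarger, Fin.forall_fin_succ (n := n)]
  simp only [prependValue_zero, prependValue_succ, Fin.succ_lt_succ_iff, Fin.not_lt_zero,
    Fin.succ_pos, forall_true_left, Fin.succAbove_lt_succAbove_iff, IsEmpty.forall_iff,
    implies_true, true_and]
  exact and_comm

theorem atMostOneLarger_prependValue_last {n : ℕ} (σ : Equiv.Perm (Fin n)) :
    AtMostOneLarger (prependValue (Fin.last n) σ) ↔ AtMostOneLarger σ := by
  rw [atMostOneLarger_prependValue_iff, and_iff_left]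
  rintro b c - ⟨h, -⟩
  exact absurd (Fin.le_last _) h.not_ge

theorem atMostOneLarger_prependValue_castSucc_last {n : ℕ} (σ : Equiv.Perm (Fin (n + 1))) :
    AtMostOneLarger (prependValue (Fin.last n).castSucc σ) ↔ AtMostOneLarger σ := by
  rw [atMostOneLarger_prependValue_iff, and_iff_left]
  rintro b c hbc
  simp only [castSucc_last_lt_succAbove]
  rintro ⟨hb, hc⟩
  exact hbc.ne (σ.injective (hb.trans hc.symm))

theorem not_atMostOneLarger_prependValue {n : ℕ} (v : Fin n) (σ : Equiv.Perm (Fin (n + 1))) :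
    ¬ AtMostOneLarger (prependValue v.castSucc.castSucc σ) := by
  rw [atMostOneLarger_prependValue_iff]
  rintro ⟨-, h⟩
  have key : ∀ x : Fin (n + 1), v.castSucc ≤ x →
      v.castSucc.castSucc < v.castSucc.castSucc.succAbove x := fun x hx => by
    rwa [Fin.lt_succAbove_iff_le_castSucc, Fin.castSucc_le_castSucc_iff]
  have h1 := key v.castSucc le_rfl
  have h2 := key v.succ (Fin.castSucc_lt_succ).le
  have hne : σ.symm v.castSucc ≠ σ.symm v.succ := fun h =>
    (Fin.castSucc_lt_succ (i := v)).ne (σ.symm.injective h)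
  rcases lt_or_gt_of_ne hne with hlt | hlt
  · exact h _ _ hlt (by simp only [Equiv.apply_symm_apply]; exact ⟨h1, h2⟩)
  · exact h _ _ hlt (by simp only [Equiv.apply_symm_apply]; exact ⟨h2, h1⟩)

theorem occ_p213_prependValue {n : ℕ} (v : Fin (n + 1)) (σ : Equiv.Perm (Fin n)) :
    occ (n + 1) p213 (prependValue v σ) = occ n p213 σ +
      ∑ b, ∑ c, if b < c ∧ v.succAbove (σ b) < v ∧ v < v.succAbove (σ c) then 1 else 0 := by
  simp only [occ_p213, Fin.sum_univ_succ (n := n)]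
  rw [add_comm]
  simp

theorem occ_p231_prependValue {n : ℕ} (v : Fin (n + 1)) (σ : Equiv.Perm (Fin n)) :
    occ (n + 1) p231 (prependValue v σ) = occ n p231 σ +
      ∑ b, ∑ c, if b < c ∧ v.succAbove (σ c) < v ∧ v < v.succAbove (σ b) then 1 else 0 := by
  simp only [occ_p231, Fin.sum_univ_succ (n := n)]
  rw [add_comm]
  simp

theorem occ_p213_prependValue_last {n : ℕ} (σ : Equiv.Perm (Fin n)) :
    occ (n + 1) p213 (prependValue (Fin.last n) σ) = occ n p213 σ := by
  simp [occ_p213_prependValue, (Fin.le_last _).not_gt]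

theorem occ_p231_prependValue_last {n : ℕ} (σ : Equiv.Perm (Fin n)) :
    occ (n + 1) p231 (prependValue (Fin.last n) σ) = occ n p231 σ := by
  simp [occ_p231_prependValue, (Fin.le_last _).not_gt]

theorem occ_p213_prependValue_castSucc_last {n : ℕ} (σ : Equiv.Perm (Fin (n + 1))) :
    occ (n + 2) p213 (prependValue (Fin.last n).castSucc σ) =
      occ (n + 1) p213 σ + (σ.symm (Fin.last n) : ℕ) := by
  rw [occ_p213_prependValue]
  congr 1
  simp only [castSucc_last_succAbove_lt, castSucc_last_lt_succAbove]
  have (b c : Fin (n + 1)) : (b < c ∧ σ b < Fin.last n ∧ σ c = Fin.last n) ↔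
      (c = σ.symm (Fin.last n) ∧ b < σ.symm (Fin.last n)) := by
    rw [Equiv.eq_symm_apply]
    constructor
    · rintro ⟨h1, -, h2⟩
      exact ⟨h2, by rwa [← h2, σ.symm_apply_apply]⟩
    · rintro ⟨h1, h2⟩
      rw [← h1, σ.symm_apply_apply] at h2
      exact ⟨h2, Fin.lt_last_iff_ne_last.2 fun h => h2.ne (σ.injective (h.trans h1.symm)), h1⟩
  simp only [this, ite_and, sum_ite_eq', mem_univ, if_true]
  rw [← Finset.card_filter, Finset.filter_gt_eq_Iio, Fin.card_Iio]

theorem occ_p231_prependValue_castSucc_last {n : ℕ} (σ : Equiv.Perm (Fin (n + 1))) :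
    occ (n + 2) p231 (prependValue (Fin.last n).castSucc σ) =
      occ (n + 1) p231 σ + (n - (σ.symm (Fin.last n) : ℕ)) := by
  rw [occ_p231_prependValue, Finset.sum_comm]
  congr 1
  simp only [castSucc_last_succAbove_lt, castSucc_last_lt_succAbove]
  have (b c : Fin (n + 1)) : (b < c ∧ σ c < Fin.last n ∧ σ b = Fin.last n) ↔
      (b = σ.symm (Fin.last n) ∧ σ.symm (Fin.last n) < c) := by
    rw [Equiv.eq_symm_apply]
    constructor
    · rintro ⟨h1, -, h2⟩
      exact ⟨h2, by rwa [← h2, σ.symm_apply_apply]⟩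
    · rintro ⟨h1, h2⟩
      rw [← h1, σ.symm_apply_apply] at h2
      exact ⟨h2, Fin.lt_last_iff_ne_last.2 fun h => h2.ne (σ.injective (h1.trans h.symm)), h1⟩
  simp only [this, ite_and, sum_ite_eq', mem_univ, if_true]
  rw [← Finset.card_filter, Finset.filter_lt_eq_Ioi, Fin.card_Ioi]
  omega

theorem symm_last_prependValue_last {n : ℕ} (σ : Equiv.Perm (Fin n)) :
    (prependValue (Fin.last n) σ).symm (Fin.last n) = 0 := by
  simp [Equiv.symm_apply_eq]

theorem symm_last_prependValue_castSucc_last {n : ℕ} (σ : Equiv.Perm (Fin (n + 1))) :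
    (prependValue (Fin.last n).castSucc σ).symm (Fin.last (n + 1)) =
      (σ.symm (Fin.last n)).succ := by
  simp [Equiv.symm_apply_eq]

open Classical in
theorem sum_avoiders_succ {n : ℕ} (Φ : Equiv.Perm (Fin (n + 2)) → ℕ) :
    ∑ σ ∈ avoiders (n + 2) [p123, p132], Φ σ = ∑ σ ∈ avoiders (n + 1) [p123, p132],
      (Φ (prependValue (Fin.last (n + 1)) σ) + Φ (prependValue (Fin.last n).castSucc σ)) := by
  have h (m : ℕ) : avoiders m [p123, p132] = univ.filter AtMostOneLarger := by
    ext σ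
    simp [mem_avoiders_iff]
  rw [h, h, Finset.sum_filter, Finset.sum_filter, ← (prependValue_bijective (n + 1)).sum_comp,
    Fintype.sum_prod_type_right]
  refine sum_congr rfl fun σ _ => ?_
  rw [Fin.sum_univ_castSucc, Fin.sum_univ_castSucc]
  simp only [not_atMostOneLarger_prependValue, if_false, sum_const_zero,
    atMostOneLarger_prependValue_last, atMostOneLarger_prependValue_castSucc_last]
  split_ifs <;> ring

/-- The sum of `x * (y - 1)` over all pairs of entries with `y` preceding `x`. -/
def List.pairSum : List ℕ → ℕ
  | [] => 0
  | x :: l => l.sum * (x - 1) + List.pairSum l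

theorem List.sum_ite_lt_eq_pairSum (l : List ℕ) :
    (∑ i : Fin l.length, ∑ j : Fin l.length, if i < j then l.get j * (l.get i - 1) else 0) =
      l.pairSum := by
  induction l with
  | nil => rfl
  | cons x l ih =>
    have h : ∑ j : Fin l.length, l[(j : ℕ)] * (x - 1) = l.sum * (x - 1) := by
      rw [← Finset.sum_mul, Fin.sum_univ_getElem]
    simp only [List.length_cons, Fin.sum_univ_succ]
    simp only [List.get_eq_getElem] at ih
    simp [ih, h, List.pairSum]

/-- The composition of `n + 1` obtained by prepending a block of size `1`. -/
def Composition.prependOne {n : ℕ} (c : Composition n) : Composition (n + 1) where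
  blocks := 1 :: c.blocks
  blocks_pos := by
    intro i hi
    rcases List.mem_cons.1 hi with rfl | hi
    · exact one_pos
    · exact c.blocks_pos hi
  blocks_sum := by simp [c.blocks_sum, add_comm]

theorem Composition.blocks_ne_nil_of_succ {n : ℕ} (c : Composition (n + 1)) : c.blocks ≠ [] := by
  intro h
  have := c.blocks_sum
  simp [h] at this

theorem Composition.head_add_sum_tail {n : ℕ} (c : Composition (n + 1)) :
    c.blocks.head c.blocks_ne_nil_of_succ + c.blocks.tail.sum = n + 1 := by
  rw [← List.sum_cons, List.cons_head_tail, c.blocks_sum]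

/-- The composition obtained by enlarging the first block by `1`. -/
def Composition.growHead {n : ℕ} (c : Composition (n + 1)) : Composition (n + 2) where
  blocks := (c.blocks.head c.blocks_ne_nil_of_succ + 1) :: c.blocks.tail
  blocks_pos := by
    intro i hi
    rcases List.mem_cons.1 hi with rfl | hi
    · exact Nat.succ_pos _
    · exact c.blocks_pos (List.mem_of_mem_tail hi)
  blocks_sum := by
    have := c.head_add_sum_tail
    rw [List.sum_cons]
    omega

theorem Composition.head_pos {n : ℕ} (c : Composition (n + 1)) :
    0 < c.blocks.head c.blocks_ne_nil_of_succ :=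
  c.blocks_pos (List.head_mem _)

theorem Composition.sum_succ {n : ℕ} (Φ : Composition (n + 2) → ℕ) :
    ∑ c, Φ c = ∑ c : Composition (n + 1), (Φ c.prependOne + Φ c.growHead) := by
  let f : Bool × Composition (n + 1) → Composition (n + 2) :=
    fun x => if x.1 then x.2.prependOne else x.2.growHead
  have hf : f.Bijective := by
    rw [Fintype.bijective_iff_injective_and_card]
    constructor
    · rintro ⟨a, c⟩ ⟨b, d⟩ h
      have hc := c.head_pos
      have hd := d.head_pos
      have h := congrArg Composition.blocks h
      cases a <;> cases b <;>
        simp only [f, Composition.prependOne, Composition.growHead, if_true, if_false,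
          List.cons.injEq, Bool.false_eq_true] at h
      · congr 1
        ext1
        rw [← List.cons_head_tail c.blocks_ne_nil_of_succ,
          ← List.cons_head_tail d.blocks_ne_nil_of_succ, h.2, Nat.succ_injective h.1]
      · omega
      · omega
      · rw [Composition.ext h.2]
    · simp [composition_card, pow_succ, mul_comm]
  rw [← hf.sum_comp, Fintype.sum_prod_type_right]
  simp [f]

/-- The position of the maximum and the numbers of occurrences of `213` and `231` are jointly
distributed on the avoiders as the first block and two block statistics on compositions. -/
theorem sum_avoiders_eq_sum_composition (n : ℕ) (Φ : ℕ → ℕ → ℕ → ℕ) :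
    ∑ σ ∈ avoiders (n + 1) [p123, p132],
      Φ (σ.symm (Fin.last n) + 1) (occ (n + 1) p213 σ) (occ (n + 1) p231 σ) =
    ∑ c : Composition (n + 1), Φ (c.blocks.head c.blocks_ne_nil_of_succ)
      (c.blocks.map fun x => (x - 1).choose 2).sum c.blocks.pairSum := by
  induction n generalizing Φ with
  | zero =>
    have h : avoiders 1 [p123, p132] = univ := by
      ext σ
      simp only [mem_avoiders_iff, mem_univ, iff_true]
      intro a b c hab
      omega
    have hc : (default : Composition 1).blocks = [1] := by decide
    have : Subsingleton (Composition 1) :=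
      Fintype.card_le_one_iff_subsingleton.1 (composition_card 1).le
    rw [Fintype.sum_subsingleton _ (default : Composition 1)]
    simp [h, occ_p213, occ_p231, hc, List.pairSum]
  | succ n ih =>
    rw [sum_avoiders_succ, Composition.sum_succ]
    simp only [symm_last_prependValue_last, symm_last_prependValue_castSucc_last,
      occ_p213_prependValue_last, occ_p231_prependValue_last,
      occ_p213_prependValue_castSucc_last, occ_p231_prependValue_castSucc_last]
    have := ih fun h x y => Φ 1 x y + Φ (h + 1) (x + (h - 1)) (y + (n + 1 - h))
    simp only [Nat.add_sub_add_right, Nat.add_sub_cancel] at this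
    simp only [Fin.val_zero, Fin.val_succ, zero_add]
    rw [this]
    refine sum_congr rfl fun c _ => ?_
    have hs := c.head_add_sum_tail
    have hp := c.head_pos
    have hl := List.cons_head_tail c.blocks_ne_nil_of_succ
    congr 1
    · simp [Composition.prependOne, List.pairSum]
    · simp only [Composition.growHead, List.head_cons]
      generalize c.blocks.head c.blocks_ne_nil_of_succ = x at *
      generalize c.blocks.tail = t at *
      rw [← hl]
      obtain ⟨y, rfl⟩ := Nat.exists_eq_succ_of_ne_zero hp.ne'
      congr 1
      · simp [Nat.choose_succ_succ' y 1]
        ring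
      · have : n + 1 - y.succ = t.sum := by omega
        simp only [List.pairSum, this, Nat.succ_eq_add_one, Nat.add_sub_cancel]
        ring

/-- Proposition `pa`: for `n ≥ 3`, `f_{213}(S_n(123,132))` is the sum over all compositions
`(c₁,…,c_k)` of `n` of `∑ᵢ C(cᵢ−1, 2)`, and `f_{231}(S_n(123,132))` is the sum over all
compositions of `n` of `∑_{i<j} c_j(c_i−1)`. -/
theorem stmt_2 (n : ℕ) (hn : 3 ≤ n) :
    fCnt n p213 [p123, p132] =
      (∑ c : Composition n, ∑ i : Fin c.length, (c.blocksFun i - 1).choose 2) ∧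
    fCnt n p231 [p123, p132] =
      ∑ c : Composition n, ∑ i : Fin c.length, ∑ j : Fin c.length,
        if i < j then c.blocksFun j * (c.blocksFun i - 1) else 0 := by
  obtain ⟨m, rfl⟩ := Nat.exists_eq_add_of_le' (show 1 ≤ n by omega)
  constructor
  · refine (sum_avoiders_eq_sum_composition m fun _ x _ => x).trans
      (sum_congr rfl fun c _ => ?_)
    exact (Fin.sum_univ_fun_getElem c.blocks fun x => (x - 1).choose 2).symm
  · refine (sum_avoiders_eq_sum_composition m fun _ _ y => y).trans
      (sum_congr rfl fun c _ => ?_)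
    exact c.blocks.sum_ite_lt_eq_pairSum.symm
end

section
/- For every integer n ≥ 3, the total number of occurrences of the pattern 213 in the set S_n(132,321) equals ∑_{1≤k<m≤n} k(m−k)(n−m), and the total number of occurrences of the pattern 312 in S_n(132,321) equals ∑_{1≤k<m≤n} k·binom(m−k, 2). -/
open Finset

theorem isOcc_p132_iff {n : ℕ} (σ : Equiv.Perm (Fin n)) (ι : Fin 3 → Fin n) :
    ((∀ j l : Fin 3, j < l → ι j < ι l) ∧
      (∀ j l : Fin 3, p132 j < p132 l ↔ σ (ι j) < σ (ι l))) ↔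
    (ι 0 < ι 1 ∧ ι 1 < ι 2 ∧ σ (ι 0) < σ (ι 2) ∧ σ (ι 2) < σ (ι 1)) := by
  simp only [Fin.forall_fin_succ, p132]
  simp
  omega

theorem isOcc_p321_iff {n : ℕ} (σ : Equiv.Perm (Fin n)) (ι : Fin 3 → Fin n) :
    ((∀ j l : Fin 3, j < l → ι j < ι l) ∧
      (∀ j l : Fin 3, p321 j < p321 l ↔ σ (ι j) < σ (ι l))) ↔
    (ι 0 < ι 1 ∧ ι 1 < ι 2 ∧ σ (ι 2) < σ (ι 1) ∧ σ (ι 1) < σ (ι 0)) := by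
  simp only [Fin.forall_fin_succ, p321]
  simp
  omega

theorem isOcc_p213_iff {n : ℕ} (σ : Equiv.Perm (Fin n)) (ι : Fin 3 → Fin n) :
    ((∀ j l : Fin 3, j < l → ι j < ι l) ∧
      (∀ j l : Fin 3, p213 j < p213 l ↔ σ (ι j) < σ (ι l))) ↔
    (ι 0 < ι 1 ∧ ι 1 < ι 2 ∧ σ (ι 1) < σ (ι 0) ∧ σ (ι 0) < σ (ι 2)) := by
  simp only [Fin.forall_fin_succ, p213]
  simp
  omega

theorem isOcc_p312_iff {n : ℕ} (σ : Equiv.Perm (Fin n)) (ι : Fin 3 → Fin n) :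
    ((∀ j l : Fin 3, j < l → ι j < ι l) ∧
      (∀ j l : Fin 3, p312 j < p312 l ↔ σ (ι j) < σ (ι l))) ↔
    (ι 0 < ι 1 ∧ ι 1 < ι 2 ∧ σ (ι 1) < σ (ι 2) ∧ σ (ι 2) < σ (ι 0)) := by
  simp only [Fin.forall_fin_succ, p312]
  simp
  omega

theorem mem_avoiders_p132_p321 {n : ℕ} (σ : Equiv.Perm (Fin n)) :
    σ ∈ avoiders n [p132, p321] ↔
      (∀ a b c : Fin n, a < b → b < c → σ a < σ c → ¬ σ c < σ b) ∧
      (∀ a b c : Fin n, a < b → b < c → σ c < σ b → ¬ σ b < σ a) := by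
  simp only [avoiders, occ, mem_filter, mem_univ, true_and, List.mem_cons, List.not_mem_nil,
    or_false, forall_eq_or_imp, forall_eq, card_eq_zero, filter_eq_empty_iff, isOcc_p132_iff,
    isOcc_p321_iff, true_imp_iff]
  simp only [not_and]
  constructor
  · rintro ⟨h, h'⟩
    exact ⟨fun a b c => @h ![a, b, c], fun a b c => @h' ![a, b, c]⟩
  · rintro ⟨h, h'⟩
    exact ⟨fun ι => h _ _ _, fun ι => h' _ _ _⟩

/-- The permutation of `Fin n` with one-line notation
`(m-k) … (m-1) 0 … (m-k-1) m … (n-1)`; the identity unless `k ≤ m ≤ n`. -/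
def blockSwap (n k m : ℕ) : Equiv.Perm (Fin n) :=
  if h : k ≤ m ∧ m ≤ n then
    { toFun := fun i => ⟨if (i : ℕ) < k then i + (m - k) else if (i : ℕ) < m then i - k else i, by
        have := i.2
        split_ifs <;> omega⟩
      invFun := fun j =>
        ⟨if (j : ℕ) < m - k then j + k else if (j : ℕ) < m then j - (m - k) else j, by
          have := j.2
          split_ifs <;> omega⟩
      left_inv := fun i => by
        ext
        dsimp only
        split_ifs <;> omega
      right_inv := fun j => by
        ext
        dsimp only
        split_ifs <;> omega }
  else 1

theorem blockSwap_apply {n k m : ℕ} (hk : k ≤ m) (hm : m ≤ n) (i : Fin n) :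
    (blockSwap n k m i : ℕ) =
      if (i : ℕ) < k then i + (m - k) else if (i : ℕ) < m then i - k else i := by
  simp [blockSwap, hk, hm]

theorem blockSwap_self {n m : ℕ} (hm : m ≤ n) : blockSwap n m m = 1 := by
  ext i
  rw [blockSwap_apply le_rfl hm, Equiv.Perm.one_apply]
  split_ifs <;> omega

theorem blockSwap_mem_avoiders {n k m : ℕ} (hk : k ≤ m) (hm : m ≤ n) :
    blockSwap n k m ∈ avoiders n [p132, p321] := by
  rw [mem_avoiders_p132_p321]
  simp only [Fin.lt_def, blockSwap_apply hk hm]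
  constructor <;> intro a b c _ _ <;> split_ifs <;> omega

/-- A permutation that is increasing from position `k` on is determined by its first `k` values. -/
theorem perm_eq_of_strictMonoOn {n k : ℕ} {σ τ : Equiv.Perm (Fin n)}
    (h : ∀ i : Fin n, (i : ℕ) < k → σ i = τ i)
    (hσ : ∀ i j : Fin n, k ≤ (i : ℕ) → i < j → σ i < σ j)
    (hτ : ∀ i j : Fin n, k ≤ (i : ℕ) → i < j → τ i < τ j) : σ = τ := by
  have key : ∀ {α β : Equiv.Perm (Fin n)} (i : Fin n), k ≤ (i : ℕ) → (∀ j < i, α j = β j) →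
      (∀ i j : Fin n, k ≤ (i : ℕ) → i < j → β i < β j) → ¬ α i < β i := by
    intro α β i hi hlt hβ hαβ
    obtain ⟨p, hp⟩ := β.surjective (α i)
    rcases lt_trichotomy p i with hpi | rfl | hpi
    · exact hpi.ne (α.injective ((hlt p hpi).trans hp))
    · exact hαβ.ne hp.symm
    · exact absurd (hβ i p hi hpi) (hp ▸ hαβ.not_gt)
  ext1 i
  induction i using WellFoundedLT.induction with
  | ind i ih =>
    rcases lt_or_ge (i : ℕ) k with hi | hi
    · exact h i hi
    · exact le_antisymm (not_lt.1 (key i hi (fun j hj => (ih j hj).symm) hσ))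
        (not_lt.1 (key i hi ih hτ))

theorem exists_eq_blockSwap {n : ℕ} (hn : 0 < n) {σ : Equiv.Perm (Fin n)}
    (hσ : σ ∈ avoiders n [p132, p321]) : ∃ k m, k ≤ m ∧ m ≤ n ∧ σ = blockSwap n k m := by
  rw [mem_avoiders_p132_p321] at hσ
  obtain ⟨h132, h321⟩ := hσ
  obtain ⟨p, hp⟩ := σ.surjective ⟨0, hn⟩
  have pos : ∀ i, i ≠ p → σ p < σ i := by
    intro i hi
    have : σ i ≠ σ p := fun h => hi (σ.injective h)
    rw [hp] at this ⊢
    simp only [ne_eq, Fin.ext_iff, Fin.lt_def] at this ⊢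
    omega
  have hleft : ∀ i j, i < j → j < p → σ i < σ j := fun i j hij hj =>
    lt_of_le_of_ne (not_lt.1 (h321 i j p hij hj (pos j hj.ne))) fun h => hij.ne (σ.injective h)
  have hright : ∀ i j : Fin n, (p : ℕ) ≤ i → i < j → σ i < σ j := by
    intro i j hi hij
    rcases eq_or_lt_of_le (show p ≤ i from hi) with rfl | hi
    · exact pos j hij.ne'
    · exact lt_of_le_of_ne (not_lt.1 (h132 p i j hi hij (pos j (hi.trans hij).ne')))
        fun h => hij.ne (σ.injective h)
  have hval : ∀ i : ℕ, ∀ hi : i < p,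
      (σ ⟨i, hi.trans p.2⟩ : ℕ) = i + σ ⟨0, hn⟩ := by
    intro i
    induction i with
    | zero => intro _; simp
    | succ i ih =>
      intro hi
      have ih := ih (by omega)
      have h1 := hleft ⟨i, by omega⟩ ⟨i + 1, by omega⟩ (by simp [Fin.lt_def]) hi
      by_contra hne
      rw [Fin.lt_def] at h1
      obtain ⟨q, hq⟩ := σ.surjective ⟨i + 1 + σ ⟨0, hn⟩, by omega⟩
      have hq' := congrArg Fin.val hq
      simp only at hq'
      have hqp : i + 1 < (q : ℕ) := by
        by_contra hqi
        rcases Nat.lt_or_ge q i with h | h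
        · have := hleft q ⟨i, by omega⟩ h (by rw [Fin.lt_def]; dsimp only; omega)
          rw [Fin.lt_def] at this
          omega
        · rcases (show (q : ℕ) = i ∨ (q : ℕ) = i + 1 by omega) with h | h
          · have : q = ⟨i, by omega⟩ := Fin.ext h
            rw [this] at hq'
            omega
          · have : q = ⟨i + 1, by omega⟩ := Fin.ext h
            rw [this] at hq'
            omega
      refine h132 ⟨i, by omega⟩ ⟨i + 1, by omega⟩ q (by simp [Fin.lt_def]) hqp ?_ ?_ <;>
        rw [Fin.lt_def] <;> omega
  have hm : (p : ℕ) + σ ⟨0, hn⟩ ≤ n := by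
    rcases Nat.eq_zero_or_pos p with h | h
    · omega
    · have h1 := hval (p - 1) (by omega)
      have := (σ ⟨p - 1, by omega⟩).2
      omega
  refine ⟨p, p + σ ⟨0, hn⟩, by omega, hm, perm_eq_of_strictMonoOn (k := p) ?_ hright ?_⟩
  · intro i hi
    ext
    rw [blockSwap_apply (by omega) hm, if_pos hi]
    have := hval i hi
    simp only [Fin.eta] at this
    omega
  · intro i j hi hij
    rw [Fin.lt_def] at *
    rw [blockSwap_apply (by omega) hm, blockSwap_apply (by omega) hm]
    split_ifs <;> omega

theorem blockSwap_injOn {n k m k' m' : ℕ} (hk : 0 < k) (hkm : k < m) (hm : m ≤ n)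
    (hk' : 0 < k') (hkm' : k' < m') (hm' : m' ≤ n) (h : blockSwap n k m = blockSwap n k' m') :
    k = k' ∧ m = m' := by
  have e : ∀ i : Fin n, (blockSwap n k m i : ℕ) = blockSwap n k' m' i := fun i => by rw [h]
  simp only [blockSwap_apply hkm.le hm, blockSwap_apply hkm'.le hm'] at e
  have h0 := e ⟨0, by omega⟩
  have h1 := e ⟨k, by omega⟩
  simp only [hk, hk', if_true, lt_irrefl, if_false, hkm] at h0 h1
  split_ifs at h1 <;> omega

theorem occ_p213_blockSwap {n k m : ℕ} (hk : k ≤ m) (hm : m ≤ n) :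
    occ n p213 (blockSwap n k m) = k * (m - k) * (n - m) := by
  have : occ n p213 (blockSwap n k m) =
      (range k ×ˢ range (m - k) ×ˢ range (n - m)).card := by
    unfold occ
    simp only [isOcc_p213_iff]
    simp only [Fin.lt_def, blockSwap_apply hk hm]
    have aux : ∀ ι : Fin 3 → Fin n, ι ∈ (univ.filter fun ι : Fin 3 → Fin n =>
        (ι 0 : ℕ) < k ∧ k ≤ (ι 1 : ℕ) ∧ (ι 1 : ℕ) < m ∧ m ≤ (ι 2 : ℕ)) ↔
        (ι 0 : ℕ) < k ∧ k ≤ (ι 1 : ℕ) ∧ (ι 1 : ℕ) < m ∧ m ≤ (ι 2 : ℕ) := by simp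
    trans (univ.filter fun ι : Fin 3 → Fin n =>
        (ι 0 : ℕ) < k ∧ k ≤ (ι 1 : ℕ) ∧ (ι 1 : ℕ) < m ∧ m ≤ (ι 2 : ℕ)).card
    · congr 1
      apply filter_congr
      intro ι _
      split_ifs <;> omega
    · refine card_bij (fun ι _ => ((ι 0 : ℕ), (ι 1 : ℕ) - k, (ι 2 : ℕ) - m)) ?_ ?_ ?_
      · intro ι hι
        rw [aux] at hι
        simp only [mem_product, mem_range]
        omega
      · intro ι hι ι' hι' h
        rw [aux] at hι hι'
        simp only [Prod.mk.injEq] at h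
        ext j
        fin_cases j <;> simp <;> omega
      · rintro ⟨a, b, c⟩ h
        simp only [mem_product, mem_range] at h
        refine ⟨![⟨a, by omega⟩, ⟨b + k, by omega⟩, ⟨c + m, by omega⟩], ?_, ?_⟩
        · rw [aux]
          simp
          omega
        · simp
  rw [this]
  simp [mul_assoc]

theorem occ_p312_blockSwap {n k m : ℕ} (hk : k ≤ m) (hm : m ≤ n) :
    occ n p312 (blockSwap n k m) = k * (m - k).choose 2 := by
  have : occ n p312 (blockSwap n k m) =
      (range k ×ˢ (range (m - k)).sigma fun j => range j).card := by
    unfold occ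
    simp only [isOcc_p312_iff]
    simp only [Fin.lt_def, blockSwap_apply hk hm]
    have aux : ∀ ι : Fin 3 → Fin n, ι ∈ (univ.filter fun ι : Fin 3 → Fin n =>
        (ι 0 : ℕ) < k ∧ k ≤ (ι 1 : ℕ) ∧ (ι 1 : ℕ) < ι 2 ∧ (ι 2 : ℕ) < m) ↔
        (ι 0 : ℕ) < k ∧ k ≤ (ι 1 : ℕ) ∧ (ι 1 : ℕ) < ι 2 ∧ (ι 2 : ℕ) < m := by simp
    trans (univ.filter fun ι : Fin 3 → Fin n =>
        (ι 0 : ℕ) < k ∧ k ≤ (ι 1 : ℕ) ∧ (ι 1 : ℕ) < ι 2 ∧ (ι 2 : ℕ) < m).card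
    · congr 1
      apply filter_congr
      intro ι _
      split_ifs <;> omega
    · refine card_bij (fun ι _ => ((ι 0 : ℕ), ⟨(ι 2 : ℕ) - k, (ι 1 : ℕ) - k⟩)) ?_ ?_ ?_
      · intro ι hι
        rw [aux] at hι
        simp only [mem_product, mem_sigma, mem_range]
        omega
      · intro ι hι ι' hι' h
        rw [aux] at hι hι'
        simp only [Prod.mk.injEq, Sigma.mk.injEq, heq_eq_eq] at h
        ext j
        fin_cases j <;> simp <;> omega
      · rintro ⟨a, b, c⟩ h
        simp only [mem_product, mem_sigma, mem_range] at h
        refine ⟨![⟨a, by omega⟩, ⟨c + k, by omega⟩, ⟨b + k, by omega⟩], ?_, ?_⟩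
        · rw [aux]
          simp
          omega
        · simp
  rw [this]
  simp [sum_range_id, Nat.choose_two_right]

theorem sum_avoiders_p132_p321 {n : ℕ} (hn : 0 < n) {f : Equiv.Perm (Fin n) → ℕ} (hf : f 1 = 0) :
    ∑ σ ∈ avoiders n [p132, p321], f σ =
      ∑ k ∈ Icc 1 n, ∑ m ∈ Icc (k + 1) n, f (blockSwap n k m) := by
  rw [sum_sigma']
  symm
  refine sum_bij_ne_zero (fun x _ _ => blockSwap n x.1 x.2) ?_ ?_ ?_ ?_
  · rintro ⟨k, m⟩ h -
    simp only [mem_sigma, mem_Icc] at h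
    exact blockSwap_mem_avoiders (Nat.le_of_lt h.2.1) h.2.2
  · rintro ⟨k, m⟩ h - ⟨k', m'⟩ h' - e
    simp only [mem_sigma, mem_Icc] at h h'
    obtain ⟨rfl, rfl⟩ := blockSwap_injOn h.1.1 h.2.1 h.2.2 h'.1.1 h'.2.1 h'.2.2 e
    rfl
  · intro σ hσ hne
    obtain ⟨k, m, hk, hm, rfl⟩ := exists_eq_blockSwap hn hσ
    have hkm : k ≠ m := by
      rintro rfl
      exact hne (by rw [blockSwap_self hm, hf])
    have hk0 : k ≠ 0 := by
      rintro rfl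
      refine hne ?_
      convert hf
      ext i
      rw [blockSwap_apply hk hm]
      simp
    exact ⟨⟨k, m⟩, by simpa only [mem_sigma, mem_Icc] using ⟨by omega, by omega, hm⟩, hne, rfl⟩
  · intros
    rfl

/-- Proposition `pe`: for `n ≥ 3`, `f_{213}(S_n(132,321)) = ∑_{1≤k<m≤n} k(m−k)(n−m)` and
`f_{312}(S_n(132,321)) = ∑_{1≤k<m≤n} k·C(m−k, 2)`. -/
theorem stmt_9 (n : ℕ) (hn : 3 ≤ n) :
    fCnt n p213 [p132, p321] =
      (∑ k ∈ Finset.Icc 1 n, ∑ m ∈ Finset.Icc (k + 1) n, k * (m - k) * (n - m)) ∧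
    fCnt n p312 [p132, p321] =
      ∑ k ∈ Finset.Icc 1 n, ∑ m ∈ Finset.Icc (k + 1) n, k * (m - k).choose 2 := by
  constructor
  · rw [fCnt, sum_avoiders_p132_p321 (by omega)
      (by rw [← blockSwap_self (Nat.zero_le n), occ_p213_blockSwap le_rfl n.zero_le]; simp)]
    refine sum_congr rfl fun k _ => sum_congr rfl fun m h => ?_
    rw [mem_Icc] at h
    exact occ_p213_blockSwap (by omega) h.2
  · rw [fCnt, sum_avoiders_p132_p321 (by omega)
      (by rw [← blockSwap_self (Nat.zero_le n), occ_p312_blockSwap le_rfl n.zero_le]; simp)]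
    refine sum_congr rfl fun k _ => sum_congr rfl fun m h => ?_
    rw [mem_Icc] at h
    exact occ_p312_blockSwap (by omega) h.2
end
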